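/- Let Γ be an infinite-horizon discounted zero-sum polymatrix switching-control Markov game with n players, let ε ≥ 0, and let σ be a stationary ε-approximate CCE of Γ. Then the marginal product policy π^σ, defined by π^σ_k(a|s) = Σ_{a_{−k} ∈ A_{−k}} σ(a, a_{−k}|s) for all k ∈ [n], s ∈ S, is an nε-approximate NE of Γ. -/

import Mathlib

open Finset

section InfiniteHorizon

variable {n : ℕ} {S : Type*} [Fintype S] [DecidableEq S] {A : Fin n → Type*}
  [∀ k, Fintype (A k)] [∀ k, DecidableEq (A k)]

/-- `f` is a probability distribution on the finite type `α`. -/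
def IsDist {α : Type*} [Fintype α] (f : α → ℝ) : Prop :=
  (∀ x, 0 ≤ f x) ∧ ∑ x, f x = 1

/-- A stationary Markov policy: a distribution on `α` for every state. -/
def IsStatPol {S : Type*} {α : Type*} [Fintype α] (π : S → α → ℝ) : Prop :=
  ∀ s : S, IsDist (π s)

/-- A valid (stationary) transition kernel. -/
def IsKer (P : S → (∀ k, A k) → S → ℝ) : Prop :=
  ∀ s a, IsDist (P s a)

/-- Rewards take values in `[-1, 1]`. -/
def IsRew (r : Fin n → S → (∀ k, A k) → ℝ) : Prop :=
  ∀ k s a, r k s a ∈ Set.Icc (-1 : ℝ) 1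

/-- `h`-step state-to-state transition matrix under the joint policy `σ`. -/
noncomputable def matPow (P : S → (∀ k, A k) → S → ℝ)
    (σ : S → (∀ k, A k) → ℝ) : ℕ → S → S → ℝ
  | 0 => fun s s' => if s = s' then 1 else 0
  | h + 1 => fun s s' => ∑ t, matPow P σ h s t * ∑ a, σ t a * P t a s'

/-- Expected one-step reward under `σ`. -/
noncomputable def expRew (σ : S → (∀ k, A k) → ℝ)
    (rk : S → (∀ k, A k) → ℝ) (s : S) : ℝ :=
  ∑ a, σ s a * rk s a

/-- `vinf γ P rk σ s` is the expected `γ`-discounted infinite-horizon reward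
`V^σ(s) = E[∑ₕ γ^(h-1) r(s_h, a_h)]`, started at state `s`. -/
noncomputable def vinf (γ : ℝ) (P : S → (∀ k, A k) → S → ℝ)
    (rk : S → (∀ k, A k) → ℝ) (σ : S → (∀ k, A k) → ℝ) (s : S) : ℝ :=
  ∑' h : ℕ, γ ^ h * ∑ s', matPow P σ h s s' * expRew σ rk s'

/-- Value under the initial distribution `ρ`. -/
noncomputable def vinfρ (γ : ℝ) (P : S → (∀ k, A k) → S → ℝ)
    (rk : S → (∀ k, A k) → ℝ) (σ : S → (∀ k, A k) → ℝ) (ρ : S → ℝ) : ℝ :=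
  ∑ s, ρ s * vinf γ P rk σ s

/-- The joint stationary policy in which player `k` plays `π'` independently
against the marginal `σ₋ₖ` of the joint policy `σ`. -/
noncomputable def deviateI (k : Fin n) (π' : S → A k → ℝ)
    (σ : S → (∀ j, A j) → ℝ) : S → (∀ j, A j) → ℝ :=
  fun s a => π' s (a k) * ∑ b : A k, σ s (Function.update a k b)

/-- The marginal stationary policy of player `k` induced by `σ`. -/
noncomputable def marginalI (σ : S → (∀ j, A j) → ℝ) (k : Fin n) :
    S → A k → ℝ :=
  fun s b => ∑ a : ∀ j, A j, if a k = b then σ s a else 0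

/-- The product policy induced by individual stationary policies `π k`. -/
def prodPolI (π : ∀ k, S → A k → ℝ) : S → (∀ j, A j) → ℝ :=
  fun s a => ∏ k, π k s (a k)

/-- `σ` is an `ε`-approximate CCE of the discounted game (w.r.t. `ρ`). -/
def IsCCEI (γ : ℝ) (P : S → (∀ k, A k) → S → ℝ)
    (r : Fin n → S → (∀ k, A k) → ℝ) (ρ : S → ℝ) (ε : ℝ)
    (σ : S → (∀ k, A k) → ℝ) : Prop :=
  ∀ k : Fin n, ∀ π' : S → A k → ℝ, IsStatPol π' →
    vinfρ γ P (r k) (deviateI k π' σ) ρ - vinfρ γ P (r k) σ ρ ≤ ε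

/-- The stationary product policy `π` is an `ε`-approximate NE (w.r.t. `ρ`). -/
def IsNEI (γ : ℝ) (P : S → (∀ k, A k) → S → ℝ)
    (r : Fin n → S → (∀ k, A k) → ℝ) (ρ : S → ℝ) (ε : ℝ)
    (π : ∀ k, S → A k → ℝ) : Prop :=
  ∀ k : Fin n, ∀ π' : S → A k → ℝ, IsStatPol π' →
    vinfρ γ P (r k) (deviateI k π' (prodPolI π)) ρ -
      vinfρ γ P (r k) (prodPolI π) ρ ≤ ε

/-- `v` is the best-response value `V^{†,σ₋ₖ}_k(s)` of player `k` against `σ`. -/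
def IsBRValI (γ : ℝ) (P : S → (∀ k, A k) → S → ℝ)
    (rk : S → (∀ k, A k) → ℝ) (σ : S → (∀ k, A k) → ℝ)
    (k : Fin n) (s : S) (v : ℝ) : Prop :=
  IsGreatest {x : ℝ | ∃ π' : S → A k → ℝ, IsStatPol π' ∧
    x = vinf γ P rk (deviateI k π' σ) s} v

/-- The game is zero-sum polymatrix. -/
def IsZSPolymatrixI (r : Fin n → S → (∀ k, A k) → ℝ) : Prop :=
  (∀ s a, ∑ k, r k s a = 0) ∧
  ∃ q : (k : Fin n) → (j : Fin n) → S → A k → A j → ℝ,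
    (∀ k j s x y, q k j s x y ∈ Set.Icc (-1 : ℝ) 1) ∧
    ∀ k s a, r k s a = ∑ j ∈ univ.filter (fun j => j ≠ k), q k j s (a k) (a j)

/-- Switching control: at every state a single player controls the transition. -/
def SwitchingControlI (P : S → (∀ k, A k) → S → ℝ) : Prop :=
  ∀ s : S, ∃ k : Fin n, ∀ a a' : ∀ j, A j, a k = a' k → P s a = P s a'

/-- Feasibility for the nonlinear program `P_NE'`. -/
def FeasNEI (γ : ℝ) (P : S → (∀ k, A k) → S → ℝ)
    (r : Fin n → S → (∀ k, A k) → ℝ)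
    (π : ∀ k, S → A k → ℝ) (w : Fin n → S → ℝ) : Prop :=
  (∀ k, IsStatPol (π k)) ∧
  ∀ k : Fin n, ∀ s, ∀ b : A k,
    (∑ a : ∀ j, A j, if a k = b then
        (∏ j ∈ univ.filter (fun j => j ≠ k), π j s (a j)) *
          (r k s a + γ * ∑ s', P s a s' * w k s')
      else 0) ≤ w k s

/-- Objective of the nonlinear program `P_NE'`. -/
noncomputable def objNEI (γ : ℝ) (P : S → (∀ k, A k) → S → ℝ)
    (r : Fin n → S → (∀ k, A k) → ℝ) (ρ : S → ℝ)
    (π : ∀ k, S → A k → ℝ) (w : Fin n → S → ℝ) : ℝ :=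
  ∑ k, ∑ s, ρ s * (w k s - vinf γ P (r k) (prodPolI π) s)

/-- Feasibility for the best-response linear program `P_BR'(σ̂)`. -/
def FeasBRI (γ : ℝ) (P : S → (∀ k, A k) → S → ℝ)
    (r : Fin n → S → (∀ k, A k) → ℝ)
    (σ' : S → (∀ k, A k) → ℝ) (w : Fin n → S → ℝ) : Prop :=
  ∀ k : Fin n, ∀ s, ∀ b : A k,
    (∑ a : ∀ j, A j, if a k = b then
        (∑ b' : A k, σ' s (Function.update a k b')) *
          (r k s a + γ * ∑ s', P s a s' * w k s')
      else 0) ≤ w k s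

/-- Objective of the best-response linear program `P_BR'(σ̂)`. -/
noncomputable def objBRI (γ : ℝ) (P : S → (∀ k, A k) → S → ℝ)
    (r : Fin n → S → (∀ k, A k) → ℝ) (ρ : S → ℝ)
    (σ' : S → (∀ k, A k) → ℝ) (w : Fin n → S → ℝ) : ℝ :=
  ∑ k, ∑ s, ρ s * (w k s - vinf γ P (r k) σ' s)

end InfiniteHorizon
section CCECollapse

variable {n : ℕ} {S : Type*} {A : Fin n → Type*} [∀ k, Fintype (A k)]

/-- The expectation of `F` when player `k` deviates to `π'` against `σ₋ₖ`. -/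
lemma sum_deviateI_mul (k : Fin n) (π' : S → A k → ℝ) (σ : S → (∀ j, A j) → ℝ) (s : S)
    (F : (∀ j, A j) → ℝ) :
    ∑ a, deviateI k π' σ s a * F a =
      ∑ x, π' s x * ∑ a, σ s a * F (Function.update a k x) := by
  have hL : ∑ a, deviateI k π' σ s a * F a =
      ∑ p : (∀ j, A j) × A k, π' s (p.1 k) * σ s (Function.update p.1 k p.2) * F p.1 := by
    rw [Fintype.sum_prod_type]
    refine Finset.sum_congr rfl fun a _ => ?_
    simp only [deviateI, Finset.mul_sum, Finset.sum_mul]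
  have hR : ∑ x, π' s x * ∑ a, σ s a * F (Function.update a k x) =
      ∑ p : (∀ j, A j) × A k, π' s p.2 * (σ s p.1 * F (Function.update p.1 k p.2)) := by
    rw [Fintype.sum_prod_type_right]
    refine Finset.sum_congr rfl fun x _ => ?_
    rw [Finset.mul_sum]
  rw [hL, hR]
  let e : (∀ j, A j) × A k → (∀ j, A j) × A k := fun p => (Function.update p.1 k p.2, p.1 k)
  have he : Function.Involutive e := fun p => by simp [e]
  refine Fintype.sum_equiv he.toPerm _ _ fun p => ?_
  simp [e, mul_assoc]

lemma isStatPol_prodPolI {π : ∀ k, S → A k → ℝ} (hπ : ∀ k, IsStatPol (π k)) :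
    IsStatPol (prodPolI π) := by
  refine fun s => ⟨fun a => Finset.prod_nonneg fun k _ => (hπ k s).1 _, ?_⟩
  simp only [prodPolI]
  rw [← Fintype.prod_sum]
  exact Finset.prod_eq_one fun k _ => (hπ k s).2

/-- Playing one's own factor against a product policy is no deviation. -/
lemma deviateI_prodPolI_self {π : ∀ k, S → A k → ℝ} (hπ : ∀ k, IsStatPol (π k)) (k : Fin n) :
    deviateI k (π k) (prodPolI π) = prodPolI π := by
  funext s a
  have h : ∀ b : A k, prodPolI π s (Function.update a k b) =
      π k s b * ∏ j ∈ Finset.univ.erase k, π j s (a j) := by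
    intro b
    rw [prodPolI, ← Finset.mul_prod_erase _ _ (Finset.mem_univ k)]
    congr 1
    · simp
    · refine Finset.prod_congr rfl fun j hj => ?_
      rw [Function.update_of_ne (Finset.ne_of_mem_erase hj)]
  simp only [deviateI, h]
  rw [← Finset.sum_mul, (hπ k s).2, one_mul, prodPolI,
    ← Finset.mul_prod_erase _ _ (Finset.mem_univ k)]

section Values

variable [Fintype S] [DecidableEq S]

lemma matPow_congr {P : S → (∀ k, A k) → S → ℝ} {σ τ : S → (∀ j, A j) → ℝ}
    (h : ∀ s s', ∑ a, σ s a * P s a s' = ∑ a, τ s a * P s a s') (m : ℕ) :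
    matPow P σ m = matPow P τ m := by
  induction m with
  | zero => rfl
  | succ m ih =>
    funext s s'
    simp only [matPow, ih, h]

lemma vinfρ_congr (γ : ℝ) {P : S → (∀ k, A k) → S → ℝ} {rk : S → (∀ k, A k) → ℝ}
    {σ τ : S → (∀ j, A j) → ℝ} (ρ : S → ℝ)
    (hP : ∀ s s', ∑ a, σ s a * P s a s' = ∑ a, τ s a * P s a s')
    (hr : ∀ s, expRew σ rk s = expRew τ rk s) :
    vinfρ γ P rk σ ρ = vinfρ γ P rk τ ρ := by
  simp only [vinfρ, vinf, matPow_congr hP, hr]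

lemma isDist_matPow {P : S → (∀ k, A k) → S → ℝ} (hP : IsKer P) {σ : S → (∀ j, A j) → ℝ}
    (hσ : IsStatPol σ) (m : ℕ) (s : S) : IsDist (matPow P σ m s) := by
  induction m with
  | zero =>
    refine ⟨fun s' => ?_, by simp [matPow]⟩
    simp only [matPow]
    split_ifs <;> norm_num
  | succ m ih =>
    refine ⟨fun s' => Finset.sum_nonneg fun t _ => mul_nonneg (ih.1 t)
      (Finset.sum_nonneg fun a _ => mul_nonneg ((hσ t).1 a) ((hP t a).1 s')), ?_⟩
    simp only [matPow]
    rw [Finset.sum_comm, ← ih.2]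
    refine Finset.sum_congr rfl fun t _ => ?_
    rw [← Finset.mul_sum, Finset.sum_comm]
    simp only [← Finset.mul_sum, (hP t _).2, mul_one, (hσ t).2]

lemma IsDist.abs_sum_mul_le {α : Type*} [Fintype α] {f : α → ℝ} (hf : IsDist f) {g : α → ℝ}
    {C : ℝ} (hg : ∀ x, |g x| ≤ C) : |∑ x, f x * g x| ≤ C := by
  calc |∑ x, f x * g x| ≤ ∑ x, |f x * g x| := Finset.abs_sum_le_sum_abs _ _
    _ ≤ ∑ x, f x * C := Finset.sum_le_sum fun x _ => by
        rw [abs_mul, abs_of_nonneg (hf.1 x)]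
        exact mul_le_mul_of_nonneg_left (hg x) (hf.1 x)
    _ = C := by rw [← Finset.sum_mul, hf.2, one_mul]

lemma summable_vinf {γ : ℝ} (hγ : γ ∈ Set.Ioo (0 : ℝ) 1) {P : S → (∀ k, A k) → S → ℝ}
    (hP : IsKer P) {rk : S → (∀ k, A k) → ℝ} (hr : ∀ s a, |rk s a| ≤ 1)
    {σ : S → (∀ j, A j) → ℝ} (hσ : IsStatPol σ) (s : S) :
    Summable fun h : ℕ => γ ^ h * ∑ s', matPow P σ h s s' * expRew σ rk s' := by
  refine Summable.of_norm_bounded (summable_geometric_of_lt_one hγ.1.le hγ.2) fun h => ?_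
  rw [Real.norm_eq_abs, abs_mul, abs_of_nonneg (pow_nonneg hγ.1.le h)]
  exact mul_le_of_le_one_right (pow_nonneg hγ.1.le h)
    ((isDist_matPow hP hσ h s).abs_sum_mul_le fun t => (hσ t).abs_sum_mul_le (hr t))

/-- In a zero-sum game the values of the players sum to zero under every joint policy. -/
lemma sum_vinfρ_eq_zero {γ : ℝ} (hγ : γ ∈ Set.Ioo (0 : ℝ) 1) {P : S → (∀ k, A k) → S → ℝ}
    (hP : IsKer P) {r : Fin n → S → (∀ k, A k) → ℝ} (hr : IsRew r)
    (hzs : ∀ s a, ∑ k, r k s a = 0) {σ : S → (∀ j, A j) → ℝ} (hσ : IsStatPol σ) (ρ : S → ℝ) :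
    ∑ k, vinfρ γ P (r k) σ ρ = 0 := by
  simp only [vinfρ]
  rw [Finset.sum_comm]
  refine Finset.sum_eq_zero fun s _ => ?_
  rw [← Finset.mul_sum]
  simp only [vinf]
  rw [← Summable.tsum_finsetSum fun k _ =>
    summable_vinf hγ hP (fun s a => abs_le.2 (hr k s a)) hσ s]
  have hrew : ∀ t, ∑ k, expRew σ (r k) t = 0 := fun t => by
    simp only [expRew]
    rw [Finset.sum_comm]
    simp only [← Finset.mul_sum, hzs, mul_zero, Finset.sum_const_zero]
  have hterm : ∀ h : ℕ,
      ∑ k, γ ^ h * ∑ s', matPow P σ h s s' * expRew σ (r k) s' = 0 := fun h => by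
    rw [← Finset.mul_sum, Finset.sum_comm]
    simp only [← Finset.mul_sum, hrew, mul_zero, Finset.sum_const_zero]
  simp only [hterm, tsum_zero, mul_zero]

end Values

section Marginals

variable [∀ k, DecidableEq (A k)]

/-- Expectations of functions of a single coordinate depend only on that marginal. -/
lemma sum_mul_comp_eval (σ : S → (∀ j, A j) → ℝ) (s : S) (c : Fin n) (h : A c → ℝ) :
    ∑ a, σ s a * h (a c) = ∑ y, marginalI σ c s y * h y := by
  simp only [marginalI, Finset.sum_mul]
  rw [Finset.sum_comm]
  refine Finset.sum_congr rfl fun a _ => ?_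
  simp [ite_mul]

/-- Policies with the same marginal of player `c` give the same expectation to every function
that depends on the action of player `c` only. -/
lemma sum_mul_congr_of_marginalI_eq {σ τ : S → (∀ j, A j) → ℝ} (s : S) (c : Fin n)
    (hm : marginalI σ c s = marginalI τ c s) {G : (∀ j, A j) → ℝ}
    (hG : ∀ a a' : ∀ j, A j, a c = a' c → G a = G a') :
    ∑ a, σ s a * G a = ∑ a, τ s a * G a := by
  have hf : Function.FactorsThrough G (fun a : ∀ j, A j => a c) := fun a a' h => hG a a' h
  have hG' : ∀ a, G a = Function.extend (fun a : ∀ j, A j => a c) G 0 (a c) :=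
    fun a => (hf.extend_apply 0 a).symm
  simp only [hG']
  rw [sum_mul_comp_eval, sum_mul_comp_eval, hm]

lemma isStatPol_marginalI {σ : S → (∀ j, A j) → ℝ} (hσ : IsStatPol σ) (k : Fin n) :
    IsStatPol (marginalI σ k) := by
  refine fun s => ⟨fun x => Finset.sum_nonneg fun a _ => ?_, ?_⟩
  · split_ifs
    · exact (hσ s).1 a
    · exact le_rfl
  · have := sum_mul_comp_eval σ s k (fun _ => 1)
    simp only [mul_one] at this
    rw [← this, (hσ s).2]

/-- The marginals of a product policy are its factors. -/
lemma marginalI_prodPolI {π : ∀ k, S → A k → ℝ} (hπ : ∀ k, IsStatPol (π k)) (k : Fin n) :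
    marginalI (prodPolI π) k = π k := by
  funext s b
  simp only [marginalI, prodPolI]
  rw [← Finset.sum_filter]
  have h := Fintype.piFinset_update_singleton_eq_filter_piFinset_eq
    (fun j => (Finset.univ : Finset (A j))) k (Finset.mem_univ b)
  rw [Fintype.piFinset_univ] at h
  rw [← h, ← Finset.prod_univ_sum, Finset.prod_eq_single k]
  · simp
  · intro j _ hj
    simpa [Function.update_of_ne hj] using (hπ j s).2
  · simp

/-- If `F` depends only on the actions of player `k` and of one further player `c`, then its
expectation under a deviation of player `k` depends on `σ` only through its marginals. -/
lemma sum_deviateI_mul_congr {σ τ : S → (∀ j, A j) → ℝ} (s : S)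
    (hm : ∀ c, marginalI σ c s = marginalI τ c s) (k c : Fin n) (π' : S → A k → ℝ)
    {F : (∀ j, A j) → ℝ} (hF : ∀ a a' : ∀ j, A j, a k = a' k → a c = a' c → F a = F a') :
    ∑ a, deviateI k π' σ s a * F a = ∑ a, deviateI k π' τ s a * F a := by
  rw [sum_deviateI_mul, sum_deviateI_mul]
  refine Finset.sum_congr rfl fun x _ => ?_
  congr 1
  refine sum_mul_congr_of_marginalI_eq s c (hm c) fun a a' h => hF _ _ (by simp) ?_
  by_cases hc : c = k
  · subst hc
    simp
  · simpa [Function.update_of_ne hc] using h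

/-- In a polymatrix game with switching control, the value of a deviation of player `k` depends
on the opponents' joint policy only through its marginals. -/
lemma vinfρ_deviateI_congr [Fintype S] [DecidableEq S] (γ : ℝ)
    {P : S → (∀ k, A k) → S → ℝ} {r : Fin n → S → (∀ k, A k) → ℝ} (ρ : S → ℝ) (hzs : IsZSPolymatrixI r)
    (hsc : SwitchingControlI P) {σ τ : S → (∀ j, A j) → ℝ}
    (hm : ∀ c, marginalI σ c = marginalI τ c) (k : Fin n) (π' : S → A k → ℝ) :
    vinfρ γ P (r k) (deviateI k π' σ) ρ = vinfρ γ P (r k) (deviateI k π' τ) ρ := by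
  have hm' : ∀ s c, marginalI σ c s = marginalI τ c s := fun s c => by rw [hm c]
  refine vinfρ_congr γ ρ (fun s s' => ?_) fun s => ?_
  · obtain ⟨c, hc⟩ := hsc s
    exact sum_deviateI_mul_congr s (hm' s) k c π' fun a a' _ h => by rw [hc a a' h]
  · obtain ⟨q, -, hq⟩ := hzs.2
    simp only [expRew, hq, Finset.mul_sum]
    rw [Finset.sum_comm, Finset.sum_comm (s := Finset.univ)]
    exact Finset.sum_congr rfl fun j _ =>
      sum_deviateI_mul_congr s (hm' s) k j π' fun a a' h h' => by rw [h, h']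

end Marginals

end CCECollapse

theorem cce_collapse_polymatrix_switching_discounted
    {n : ℕ} {S : Type*} [Fintype S] [DecidableEq S] {A : Fin n → Type*}
    [∀ k, Fintype (A k)] [∀ k, DecidableEq (A k)]
    (γ : ℝ) (P : S → (∀ k, A k) → S → ℝ)
    (r : Fin n → S → (∀ k, A k) → ℝ) (ρ : S → ℝ) (ε : ℝ)
    (σ : S → (∀ k, A k) → ℝ)
    (hγ : γ ∈ Set.Ioo (0 : ℝ) 1) (hP : IsKer P) (hr : IsRew r)
    (hρ : IsDist ρ) (hzs : IsZSPolymatrixI r) (hsc : SwitchingControlI P)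
    (hε : 0 ≤ ε) (hσ : IsStatPol σ) (hCCE : IsCCEI γ P r ρ ε σ) :
    IsNEI γ P r ρ ((n : ℝ) * ε) (fun k => marginalI σ k) := by
  have hπ : ∀ k, IsStatPol (marginalI σ k) := isStatPol_marginalI hσ
  have hm : ∀ c, marginalI (prodPolI fun k => marginalI σ k) c = marginalI σ c :=
    marginalI_prodPolI hπ
  intro k π' hπ'
  have hdev : vinfρ γ P (r k) (deviateI k π' (prodPolI fun k => marginalI σ k)) ρ ≤
      vinfρ γ P (r k) σ ρ + ε := by
    rw [vinfρ_deviateI_congr γ ρ hzs hsc hm k π']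
    linarith [hCCE k π' hπ']
  have hself : ∀ j, vinfρ γ P (r j) (prodPolI fun k => marginalI σ k) ρ ≤
      vinfρ γ P (r j) σ ρ + ε := fun j => by
    rw [← deviateI_prodPolI_self hπ j, vinfρ_deviateI_congr γ ρ hzs hsc hm j]
    linarith [hCCE j _ (hπ j)]
  have hsumσ := sum_vinfρ_eq_zero hγ hP hr hzs.1 hσ ρ
  have hsumπ := sum_vinfρ_eq_zero hγ hP hr hzs.1 (isStatPol_prodPolI hπ) ρ
  have hle := Finset.sum_le_sum fun j (_ : j ∈ Finset.univ.erase k) => hself j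
  have hconst : ∑ _j : Fin n, ε = n * ε := by simp
  rw [Finset.sum_add_distrib] at hle
  rw [← Finset.add_sum_erase _ _ (Finset.mem_univ k)] at hsumσ hsumπ hconst
  linarith
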